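/- arXiv:2010.03867 — 3 statements merged into one kernel-verified Lean document; each statement's English description precedes it below -/
import Mathlib

section
/- Nondegeneracy implies invertibility of Db: Let b ∈ C¹(B₁; ℝ^d) satisfy condition (N) with constant K > 0 on B₁ ⊂ ℝ^d. Then for every v₀ ∈ B₁ the Jacobian matrix Db(v₀) is invertible and its inverse satisfies the operator-norm bound ‖Db(v₀)^{−1}‖ ≤ C(d) K, where C(d) > 0 depends only on the dimension d. -/
open MeasureTheory Metric
open scoped RealInnerProductSpace

/-- Condition (N) with constant `K` on an open set `U ⊆ ℝ^d`: for every ball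
`B_r(v₀)` with `B_{2r}(v₀) ⊆ U`, all `μ ∈ ℝ`, unit vectors `ν`, and `ε > 0`,
`|{v ∈ B_r(v₀) : |μ + b(v)·ν| ≤ ε}| ≤ K r^{d-1} ε`. -/
def CondN (d : ℕ) (K : ℝ) (U : Set (EuclideanSpace ℝ (Fin d)))
    (b : EuclideanSpace ℝ (Fin d) → EuclideanSpace ℝ (Fin d)) : Prop :=
  ∀ (v₀ : EuclideanSpace ℝ (Fin d)) (r : ℝ), 0 < r → ball v₀ (2 * r) ⊆ U →
    ∀ (μ ε : ℝ) (ν : EuclideanSpace ℝ (Fin d)), ‖ν‖ = 1 → 0 < ε →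
      volume {v : EuclideanSpace ℝ (Fin d) |
          v ∈ ball v₀ r ∧ |μ + ⟪b v, ν⟫| ≤ ε}
        ≤ ENNReal.ofReal (K * r ^ ((d : ℝ) - 1) * ε)

/-- The key lower bound for the adjoint of the Jacobian. -/
lemma adjoint_lower_bound (d : ℕ) (K : ℝ)
    (b : EuclideanSpace ℝ (Fin d) → EuclideanSpace ℝ (Fin d)) (hK : 0 < K)
    (hN : CondN d K (ball 0 1) b) (v₀ : EuclideanSpace ℝ (Fin d))
    (hv : v₀ ∈ ball (0 : EuclideanSpace ℝ (Fin d)) 1)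
    (A : EuclideanSpace ℝ (Fin d) →L[ℝ] EuclideanSpace ℝ (Fin d))
    (hA : HasFDerivAt b A v₀) (ν : EuclideanSpace ℝ (Fin d)) (hν : ‖ν‖ = 1) :
    (volume (ball (0 : EuclideanSpace ℝ (Fin d)) 1)).toReal
      ≤ K * ‖ContinuousLinearMap.adjoint A ν‖ := by
  set w := ContinuousLinearMap.adjoint A ν with hw
  set ω := (volume (ball (0 : EuclideanSpace ℝ (Fin d)) 1)).toReal with hω
  have key : ∀ δ : ℝ, 0 < δ → ω ≤ K * (‖w‖ + δ) := by
    intro δ hδ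
    have h1 := hA.isLittleO.def hδ
    obtain ⟨ρ, hρ, hball⟩ := Metric.eventually_nhds_iff_ball.1 h1
    obtain ⟨s, hs, hsub⟩ := Metric.isOpen_iff.1 isOpen_ball v₀ hv
    set r := min ρ (s / 2) with hr
    have hr0 : 0 < r := lt_min hρ (by positivity)
    have hrs : 2 * r ≤ s := by
      have := min_le_right ρ (s / 2)
      linarith
    have hε : 0 < (‖w‖ + δ) * r := by positivity
    have hvol := hN v₀ r hr0 ((ball_subset_ball hrs).trans hsub) (-⟪b v₀, ν⟫)
      ((‖w‖ + δ) * r) ν hν hε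
    have hset : ball v₀ r ⊆ {v : EuclideanSpace ℝ (Fin d) |
          v ∈ ball v₀ r ∧ |-⟪b v₀, ν⟫ + ⟪b v, ν⟫| ≤ (‖w‖ + δ) * r} := by
      intro v hvr
      refine ⟨hvr, ?_⟩
      have h2 := hball v (ball_subset_ball (min_le_left _ _) hvr)
      have h3 : ‖v - v₀‖ ≤ r := (mem_ball_iff_norm.1 hvr).le
      have e : -⟪b v₀, ν⟫ + ⟪b v, ν⟫ = ⟪b v - b v₀ - A (v - v₀), ν⟫ + ⟪v - v₀, w⟫ := by
        rw [hw, ContinuousLinearMap.adjoint_inner_right, inner_sub_left, inner_sub_left]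
        ring
      rw [e]
      have a1 := abs_real_inner_le_norm (b v - b v₀ - A (v - v₀)) ν
      have a2 := abs_real_inner_le_norm (v - v₀) w
      rw [hν, mul_one] at a1
      have a3 := abs_add_le ⟪b v - b v₀ - A (v - v₀), ν⟫ ⟪v - v₀, w⟫
      have a4 := mul_le_mul_of_nonneg_right h3 (norm_nonneg w)
      have a5 := mul_le_mul_of_nonneg_left h3 hδ.le
      linarith
    have h4 := (measure_mono hset).trans hvol
    rw [Measure.addHaar_ball_of_pos volume v₀ hr0, finrank_euclideanSpace_fin] at h4
    have h5 := ENNReal.toReal_mono ENNReal.ofReal_ne_top h4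
    rw [ENNReal.toReal_mul, ENNReal.toReal_ofReal (by positivity),
      ENNReal.toReal_ofReal (by positivity), Real.rpow_sub_one hr0.ne', Real.rpow_natCast] at h5
    have h6 : K * (r ^ d / r) * ((‖w‖ + δ) * r) = r ^ d * (K * (‖w‖ + δ)) := by
      field_simp
    rw [h6] at h5
    exact le_of_mul_le_mul_left h5 (by positivity)
  refine le_of_forall_pos_le_add fun η hη => ?_
  have := key (η / K) (by positivity)
  rwa [mul_add, mul_div_cancel₀ _ hK.ne'] at this

/-- **Nondegeneracy implies invertibility of `Db`.** If `b ∈ C¹(B₁; ℝ^d)` satisfies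
condition (N) with constant `K > 0` on `B₁`, then for every `v₀ ∈ B₁` the Jacobian
`Db(v₀)` is invertible, with `‖Db(v₀)⁻¹‖ ≤ C(d) K` for a dimensional constant `C(d)`. -/
theorem condN_implies_invertible_jacobian (d : ℕ) (hd : 1 ≤ d) :
    ∃ C : ℝ, 0 < C ∧
      ∀ (K : ℝ) (b : EuclideanSpace ℝ (Fin d) → EuclideanSpace ℝ (Fin d)),
        0 < K → ContDiffOn ℝ 1 b (ball 0 1) → CondN d K (ball 0 1) b →
        ∀ v₀ ∈ ball (0 : EuclideanSpace ℝ (Fin d)) 1,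
          ∃ L : EuclideanSpace ℝ (Fin d) →L[ℝ] EuclideanSpace ℝ (Fin d),
            (fderivWithin ℝ b (ball 0 1) v₀).comp L = ContinuousLinearMap.id ℝ _ ∧
            L.comp (fderivWithin ℝ b (ball 0 1) v₀) = ContinuousLinearMap.id ℝ _ ∧
            ‖L‖ ≤ C * K := by
  set ω := (volume (ball (0 : EuclideanSpace ℝ (Fin d)) 1)).toReal with hω
  have hω0 : 0 < ω := ENNReal.toReal_pos (measure_ball_pos _ _ one_pos).ne' measure_ball_lt_top.ne
  refine ⟨1 / ω, by positivity, ?_⟩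
  intro K b hK hb hN v₀ hv
  have hA : HasFDerivAt b (fderivWithin ℝ b (ball 0 1) v₀) v₀ :=
    ((hb.differentiableOn one_ne_zero v₀ hv).hasFDerivWithinAt).hasFDerivAt
      (isOpen_ball.mem_nhds hv)
  set A := fderivWithin ℝ b (ball 0 1) v₀ with hAdef
  set T := ContinuousLinearMap.adjoint A with hT
  have hlow : ∀ x, ω * ‖x‖ ≤ K * ‖T x‖ := by
    intro x
    by_cases hx : x = 0
    · simp [hx]
    have hx' : 0 < ‖x‖ := norm_pos_iff.2 hx
    have := adjoint_lower_bound d K b hK hN v₀ hv A hA (‖x‖⁻¹ • x)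
      (by rw [norm_smul, norm_inv, norm_norm, inv_mul_cancel₀ hx'.ne'])
    rw [← hT, map_smul, norm_smul, norm_inv, norm_norm, ← hω] at this
    have h2 := mul_le_mul_of_nonneg_right this hx'.le
    have h3 : K * (‖x‖⁻¹ * ‖T x‖) * ‖x‖ = K * ‖T x‖ := by field_simp
    linarith
  have hinj : Function.Injective (T : EuclideanSpace ℝ (Fin d) →ₗ[ℝ] EuclideanSpace ℝ (Fin d)) := by
    rw [injective_iff_map_eq_zero]
    intro x hx
    have h := hlow x
    have hx2 : T x = 0 := hx
    rw [hx2, norm_zero, mul_zero] at h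
    by_contra hne
    have := mul_pos hω0 (norm_pos_iff.2 hne)
    linarith
  let e := LinearEquiv.ofInjectiveEndo _ hinj
  let M : EuclideanSpace ℝ (Fin d) →L[ℝ] EuclideanSpace ℝ (Fin d) :=
    LinearMap.toContinuousLinearMap (e.symm : EuclideanSpace ℝ (Fin d) →ₗ[ℝ] EuclideanSpace ℝ (Fin d))
  have hTM : T.comp M = ContinuousLinearMap.id ℝ _ := by
    ext1 x
    exact e.apply_symm_apply x
  have hMT : M.comp T = ContinuousLinearMap.id ℝ _ := by
    ext1 x
    exact e.symm_apply_apply x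
  have hTA : ContinuousLinearMap.adjoint T = A := ContinuousLinearMap.adjoint_adjoint A
  refine ⟨ContinuousLinearMap.adjoint M, ?_, ?_, ?_⟩
  · rw [← hTA, ← ContinuousLinearMap.adjoint_comp, hMT, ContinuousLinearMap.adjoint_id]
  · rw [← hTA, ← ContinuousLinearMap.adjoint_comp, hTM, ContinuousLinearMap.adjoint_id]
  · rw [LinearIsometryEquiv.norm_map]
    refine ContinuousLinearMap.opNorm_le_bound _ (by positivity) fun y => ?_
    have h := hlow (M y)
    have h2 : T (M y) = y := congrArg (fun f => f y) hTM
    rw [h2] at h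
    rw [div_mul_eq_mul_div, one_mul, div_mul_eq_mul_div, le_div_iff₀ hω0]
    linarith
end

section
/- Invertibility of Db implies nondegeneracy: Let b ∈ C¹(B₁; ℝ^d) be such that Db(v) is invertible for every v ∈ B₁ with ‖Db(v)^{−1}‖ ≤ κ for some κ > 0. Then b satisfies condition (N) on B_{1/2} with a constant K > 0 depending only on d, κ, and ‖Db‖_{L^∞(B₁)}; that is, for every ball B_r(v₀) with B_{2r}(v₀) ⊂ B_{1/2}, all μ ∈ ℝ, all unit vectors ν ∈ ℝ^d, and all ε > 0, |{v ∈ B_r(v₀) : |μ + b(v)·ν| ≤ ε}| ≤ K r^{d−1} ε. -/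
open MeasureTheory Metric
open scoped RealInnerProductSpace

theorem chain_inj {E : Type*} [NormedAddCommGroup E] [NormedSpace ℝ E] (b : E → E) (v : E)
    (r δ κ M : ℝ) (hδ : 0 < δ) (hκ : 0 < κ) (hM : 0 < M)
    (hi : ∀ x ∈ ball v r, ∀ x' ∈ ball v r, ‖x - x'‖ ≤ δ → ‖x - x'‖ ≤ 2 * κ * ‖b x - b x'‖)
    (hii : ∀ x ∈ ball v r, ∀ z, ‖z - b x‖ ≤ δ / (2 * κ) →
      ∃ x', b x' = z ∧ ‖x' - x‖ ≤ 2 * κ * ‖z - b x‖)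
    (hL : ∀ x ∈ ball v r, ∀ x' ∈ ball v r, ‖b x - b x'‖ ≤ M * ‖x - x'‖)
    (ρ : ℝ) (hρ : ρ * (1 + 4 * κ * M) = r) :
    Set.InjOn b (ball v ρ) := by
  intro w1 hw1 w2 hw2 hw
  have hρ0 : 0 < ρ := lt_of_le_of_lt dist_nonneg hw1
  have hρr : ρ ≤ r := by rw [← hρ]; nlinarith [mul_pos hκ hM]
  obtain ⟨D, hD⟩ : ∃ D, D = 2 * M * ρ := ⟨_, rfl⟩
  have hD0 : 0 < D := by rw [hD]; positivity
  have hDr : ρ + 2 * κ * D = r := by rw [hD, ← hρ]; ring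
  obtain ⟨h, hh⟩ : ∃ h, h = δ / (δ + 8 * κ * D) := ⟨_, rfl⟩
  have hpos : 0 < δ + 8 * κ * D := by positivity
  have hh0 : 0 < h := by rw [hh]; positivity
  have hh1 : h < 1 := by rw [hh, div_lt_one hpos]; have : 0 < κ * D := by positivity
                         linarith
  have hhD : 8 * κ * D * h ≤ δ := by
    have : h * (δ + 8 * κ * D) = δ := by rw [hh]; field_simp
    nlinarith
  obtain ⟨q, hq⟩ : ∃ q, q = 1 - h := ⟨_, rfl⟩
  have hq0 : 0 < q := by linarith
  have hq1 : q < 1 := by linarith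
  obtain ⟨N, hN⟩ : ∃ N : ℕ, ‖w1 - w2‖ * (2 / δ + 4 * κ * M / δ) < N := exists_nat_gt _
  have hN0 : (0 : ℝ) < N := lt_of_le_of_lt (by positivity) hN
  obtain ⟨η, hη⟩ : ∃ η, η = ‖w1 - w2‖ / N := ⟨_, rfl⟩
  have hη0 : 0 ≤ η := by rw [hη]; positivity
  have hηb : η * (2 + 4 * κ * M) ≤ δ := by
    have h1 : ‖w1 - w2‖ * (2 + 4 * κ * M) < N * δ := by
      have := mul_lt_mul_of_pos_right hN hδ
      have e : ‖w1 - w2‖ * (2 / δ + 4 * κ * M / δ) * δ = ‖w1 - w2‖ * (2 + 4 * κ * M) := by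
        field_simp
      linarith
    rw [hη, div_mul_eq_mul_div, div_le_iff₀ hN0]; linarith
  have hηκ : 0 ≤ η * (κ * M) := by positivity
  have key : ∀ k : ℕ, ∃ x : ℕ → E, x 0 = w1 ∧ x N = w2 ∧
      (∀ i ≤ N, ‖x i - v‖ < ρ + 2 * κ * D * (1 - q ^ k) ∧ ‖b (x i) - b w1‖ ≤ D * q ^ k) ∧
      (∀ i < N, ‖x i - x (i + 1)‖ ≤ δ / 2 ∧ ‖b (x i) - b (x (i + 1))‖ ≤ M * η * q ^ k) := by
    intro k
    induction k with
    | zero =>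
      have hmem : ∀ i ≤ N, w1 + ((i : ℝ) / N) • (w2 - w1) ∈ ball v ρ := by
        intro i hiN
        apply (convex_ball v ρ).add_smul_sub_mem hw1 hw2
        have : (i : ℝ) ≤ N := by exact_mod_cast hiN
        exact ⟨by positivity, (div_le_one hN0).2 this⟩
      have hsub := ball_subset_ball (x := v) hρr
      have hstep : ∀ i : ℕ, ‖(w1 + ((i : ℝ) / N) • (w2 - w1)) -
          (w1 + (((i + 1 : ℕ) : ℝ) / N) • (w2 - w1))‖ = η := by
        intro i
        have : (w1 + ((i : ℝ) / N) • (w2 - w1)) -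
          (w1 + (((i + 1 : ℕ) : ℝ) / N) • (w2 - w1)) = (1 / (N : ℝ)) • (w1 - w2) := by
          push_cast
          rw [add_div]
          module
        rw [this, norm_smul, hη, Real.norm_of_nonneg (by positivity)]
        ring
      refine ⟨fun i => w1 + ((i : ℝ) / N) • (w2 - w1), by simp, ?_, ?_, ?_⟩
      · simp only; rw [div_self hN0.ne']; simp
      · intro i hiN
        refine ⟨by simpa [dist_eq_norm] using hmem i hiN, ?_⟩
        have h1 := hL _ (hsub (hmem i hiN)) _ (hsub hw1)
        have h2 : ‖w1 + ((i : ℝ) / N) • (w2 - w1) - w1‖ ≤ 2 * ρ := by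
          have e1 := hmem i hiN
          rw [mem_ball] at e1 hw1
          rw [← dist_eq_norm]
          have := dist_triangle_right (w1 + ((i : ℝ) / N) • (w2 - w1)) w1 v
          linarith
        have h3 := mul_le_mul_of_nonneg_left h2 hM.le
        simp only [pow_zero, mul_one]
        linarith
      · intro i hiN
        refine ⟨?_, ?_⟩
        · simp only; rw [hstep]; linarith
        · have h1 := hL _ (hsub (hmem i hiN.le)) _ (hsub (hmem (i+1) hiN))
          rw [hstep] at h1
          simpa using h1
    | succ k ih =>
      obtain ⟨x, hx0, hxN, hx1, hx2⟩ := ih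
      have hqk : 0 < q ^ k := pow_pos hq0 k
      have hqk1 : q ^ k ≤ 1 := pow_le_one₀ hq0.le hq1.le
      have hin : ∀ i ≤ N, x i ∈ ball v r := by
        intro i hiN
        rw [mem_ball, dist_eq_norm]
        have := (hx1 i hiN).1
        have : 0 < κ * D * q ^ k := by positivity
        linarith
      have hz : ∀ i, ‖(b w1 + q • (b (x i) - b w1)) - b (x i)‖ = h * ‖b (x i) - b w1‖ := by
        intro i
        have : (b w1 + q • (b (x i) - b w1)) - b (x i) = -(h • (b (x i) - b w1)) := by
          rw [hq]; module
        rw [this, norm_neg, norm_smul, Real.norm_of_nonneg hh0.le]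
      have hex : ∀ i, ∃ x', i ≤ N → b x' = b w1 + q • (b (x i) - b w1) ∧
          ‖x' - x i‖ ≤ 2 * κ * (h * ‖b (x i) - b w1‖) := by
        intro i
        by_cases hiN : i ≤ N
        · obtain ⟨x', h1, h2⟩ := hii (x i) (hin i hiN) (b w1 + q • (b (x i) - b w1)) (by
            rw [hz, le_div_iff₀ (by positivity)]
            have h1 := (hx1 i hiN).2
            have h2 : ‖b (x i) - b w1‖ ≤ D := by nlinarith
            have h3 := mul_le_mul_of_nonneg_left h2 (mul_pos hh0 hκ).le
            have : 0 < κ * D * h := by positivity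
            linarith)
          rw [hz] at h2
          exact ⟨x', fun _ => ⟨h1, h2⟩⟩
        · exact ⟨0, fun h => absurd h hiN⟩
      choose x' hx' using hex
      have hfix : ∀ i ≤ N, b (x i) = b w1 → x' i = x i := by
        intro i hiN hb
        have := (hx' i hiN).2
        rw [hb, sub_self, norm_zero, mul_zero, mul_zero] at this
        exact sub_eq_zero.1 (norm_le_zero_iff.1 this)
      have hmove : ∀ i ≤ N, ‖x' i - x i‖ ≤ 2 * κ * D * (h * q ^ k) := by
        intro i hiN
        have h1 := mul_le_mul_of_nonneg_left (hx1 i hiN).2 (mul_pos hκ hh0).le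
        have := (hx' i hiN).2
        linarith
      have hin' : ∀ i ≤ N, ‖x' i - v‖ < ρ + 2 * κ * D * (1 - q ^ (k + 1)) := by
        intro i hiN
        have h1 := norm_sub_le_norm_sub_add_norm_sub (x' i) (x i) v
        have h2 := hmove i hiN
        have h3 := (hx1 i hiN).1
        have e : q ^ (k + 1) = q ^ k - h * q ^ k := by rw [pow_succ, hq]; ring
        rw [e]
        linarith
      have hin'' : ∀ i ≤ N, x' i ∈ ball v r := by
        intro i hiN
        rw [mem_ball, dist_eq_norm]
        have := hin' i hiN
        have : 0 < κ * D * q ^ (k + 1) := by positivity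
        linarith
      refine ⟨x', ?_, ?_, ?_, ?_⟩
      · rw [hfix 0 (Nat.zero_le _) (by rw [hx0]), hx0]
      · rw [hfix N le_rfl (by rw [hxN, hw]), hxN]
      · intro i hiN
        refine ⟨hin' i hiN, ?_⟩
        rw [(hx' i hiN).1, add_sub_cancel_left, norm_smul, Real.norm_of_nonneg hq0.le, pow_succ]
        have := mul_le_mul_of_nonneg_left (hx1 i hiN).2 hq0.le
        linarith
      · intro i hiN
        have hb : ‖b (x' i) - b (x' (i + 1))‖ ≤ M * η * q ^ (k + 1) := by
          rw [(hx' i hiN.le).1, (hx' (i+1) hiN).1]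
          have : b w1 + q • (b (x i) - b w1) - (b w1 + q • (b (x (i + 1)) - b w1))
            = q • (b (x i) - b (x (i + 1))) := by module
          rw [this, norm_smul, Real.norm_of_nonneg hq0.le, pow_succ]
          have := mul_le_mul_of_nonneg_left (hx2 i hiN).2 hq0.le
          linarith
        refine ⟨?_, hb⟩
        have hd : ‖x' i - x' (i + 1)‖ ≤ δ := by
          have h1 := norm_sub_le_norm_sub_add_norm_sub (x' i) (x i) (x' (i + 1))
          have h2 := norm_sub_le_norm_sub_add_norm_sub (x i) (x (i + 1)) (x' (i + 1))
          have h3 := hmove i hiN.le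
          have h4 := hmove (i+1) hiN
          rw [norm_sub_rev] at h4
          have h5 := (hx2 i hiN).1
          have h6 : 2 * κ * D * (h * q ^ k) ≤ 2 * κ * D * h := by
            have : 0 < κ * D * h := by positivity
            nlinarith
          linarith
        have h1 := hi _ (hin'' i hiN.le) _ (hin'' (i + 1) hiN) hd
        have h2 : q ^ (k + 1) ≤ 1 := pow_le_one₀ hq0.le hq1.le
        have h3 := mul_le_mul_of_nonneg_left (hb.trans (mul_le_of_le_one_right (by positivity) h2))
          hκ.le
        linarith
  have hbd : ∀ k : ℕ, ‖w1 - w2‖ ≤ N * (2 * κ * (M * η)) * q ^ k := by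
    intro k
    obtain ⟨x, hx0, hxN, hx1, hx2⟩ := key k
    have hin : ∀ i ≤ N, x i ∈ ball v r := by
      intro i hiN
      rw [mem_ball, dist_eq_norm]
      have := (hx1 i hiN).1
      have : 0 < κ * D * q ^ k := by positivity
      linarith
    have h1 := dist_le_range_sum_dist x N
    rw [hx0, hxN, dist_eq_norm] at h1
    refine h1.trans ?_
    calc ∑ i ∈ Finset.range N, dist (x i) (x (i + 1))
        ≤ ∑ i ∈ Finset.range N, (2 * κ * (M * η)) * q ^ k := by
          apply Finset.sum_le_sum
          intro i hiN
          rw [Finset.mem_range] at hiN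
          rw [dist_eq_norm]
          have h2 := hi _ (hin i hiN.le) _ (hin (i + 1) hiN) (by have := (hx2 i hiN).1; linarith)
          have h3 := mul_le_mul_of_nonneg_left (hx2 i hiN).2 hκ.le
          linarith
      _ = _ := by simp; ring
  have hlim : Filter.Tendsto (fun k : ℕ => N * (2 * κ * (M * η)) * q ^ k) Filter.atTop
      (nhds (N * (2 * κ * (M * η)) * 0)) :=
    (tendsto_pow_atTop_nhds_zero_of_lt_one hq0.le hq1).const_mul _
  have := ge_of_tendsto' hlim hbd
  rw [mul_zero] at this
  exact sub_eq_zero.1 (norm_le_zero_iff.1 this)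

theorem slab_vol (d : ℕ) (hd : 1 ≤ d) (c ν : EuclideanSpace ℝ (Fin d)) (hν : ‖ν‖ = 1)
    (R μ ε : ℝ) :
    volume {y : EuclideanSpace ℝ (Fin d) | y ∈ closedBall c R ∧ |μ + ⟪y, ν⟫| ≤ ε}
      ≤ ENNReal.ofReal (2 * ε) * ENNReal.ofReal (2 * R) ^ (d - 1) := by
  obtain ⟨n, rfl⟩ : ∃ n, d = n + 1 := ⟨d - 1, by omega⟩
  have ho : Orthonormal ℝ (({0} : Set (Fin (n+1))).domRestrict (fun _ => ν)) := by
    constructor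
    · intro i; exact hν
    · intro i j hij
      exact absurd (Subsingleton.elim i j) hij
  obtain ⟨B, hB⟩ := ho.exists_orthonormalBasis_extension_of_card_eq (by simp)
  have hB0 : B 0 = ν := hB 0 (by simp)
  let f : EuclideanSpace ℝ (Fin (n+1)) → (Fin (n+1) → ℝ) := fun y => WithLp.ofLp (B.repr y)
  have hf : MeasurePreserving f volume volume :=
    (PiLp.volume_preserving_ofLp (Fin (n+1))).comp B.measurePreserving_repr
  have hfi : ∀ y i, f y i = ⟪B i, y⟫ := fun y i => B.repr_apply_apply y i
  let a : Fin (n+1) → ℝ := Fin.cons (-μ - ε) (fun i => f c i.succ - R)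
  let e : Fin (n+1) → ℝ := Fin.cons (-μ + ε) (fun i => f c i.succ + R)
  have hsub : {y : EuclideanSpace ℝ (Fin (n+1)) | y ∈ closedBall c R ∧ |μ + ⟪y, ν⟫| ≤ ε}
      ⊆ f ⁻¹' (Set.Icc a e) := by
    rintro y ⟨hy, hy2⟩
    have h0 : f y 0 = ⟪y, ν⟫ := by rw [hfi, hB0, real_inner_comm]
    have hs : ∀ i, |f y i - f c i| ≤ R := by
      intro i
      rw [hfi, hfi, ← inner_sub_right]
      refine (abs_real_inner_le_norm _ _).trans ?_
      rw [B.norm_eq_one, one_mul, ← dist_eq_norm]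
      exact hy
    rw [abs_le] at hy2
    rw [Set.mem_preimage, Set.mem_Icc, Pi.le_def, Pi.le_def]
    refine ⟨fun i => ?_, fun i => ?_⟩ <;> refine Fin.cases ?_ (fun j => ?_) i
    · simp only [a, Fin.cons_zero, h0]; linarith
    · simp only [a, Fin.cons_succ]; have := abs_le.1 (hs j.succ); linarith
    · simp only [e, Fin.cons_zero, h0]; linarith
    · simp only [e, Fin.cons_succ]; have := abs_le.1 (hs j.succ); linarith
  refine (measure_mono hsub).trans ?_
  rw [hf.measure_preimage measurableSet_Icc.nullMeasurableSet, Real.volume_Icc_pi,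
    Fin.prod_univ_succ]
  simp only [a, e, Fin.cons_zero, Fin.cons_succ]
  apply le_of_eq
  congr 1
  · congr 1; ring
  · simp only [add_sub_sub_cancel, Finset.prod_const, Finset.card_univ, Fintype.card_fin, Nat.add_sub_cancel, two_mul]

theorem det_bound (d : ℕ) (κ : ℝ) (hκ : 0 < κ)
    (L : EuclideanSpace ℝ (Fin d) →L[ℝ] EuclideanSpace ℝ (Fin d)) (hL : ‖L‖ ≤ κ) :
    |L.det| ≤ κ ^ d := by
  have h := Measure.addHaar_image_continuousLinearMap (volume : Measure (EuclideanSpace ℝ (Fin d)))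
    L (closedBall 0 1)
  have hs : L '' (closedBall 0 1) ⊆ closedBall 0 κ := by
    rintro _ ⟨x, hx, rfl⟩
    rw [mem_closedBall_zero_iff] at *
    exact (L.le_opNorm x).trans (by nlinarith [norm_nonneg x, norm_nonneg L])
  have h2 := measure_mono (μ := volume) hs
  rw [h, Measure.addHaar_closedBall' _ _ hκ.le, finrank_euclideanSpace_fin] at h2
  have h3 := (ENNReal.mul_le_mul_iff_left (measure_closedBall_pos volume
    (0 : EuclideanSpace ℝ (Fin d)) one_pos).ne' measure_closedBall_lt_top.ne).1 h2
  exact (ENNReal.ofReal_le_ofReal_iff (by positivity)).1 h3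

theorem cover (d : ℕ) (a : ℝ) (ha : 0 < a) : ∃ t : Finset (EuclideanSpace ℝ (Fin d)),
    ∀ (v₀ : EuclideanSpace ℝ (Fin d)) (r : ℝ), 0 < r →
      (∀ c ∈ t, ball (v₀ + r • c) r ⊆ ball v₀ (2 * r)) ∧
      ball v₀ r ⊆ ⋃ c ∈ t, ball (v₀ + r • c) (r * a) := by
  obtain ⟨t, ht, hfin, hc⟩ := (isCompact_closedBall (0 : EuclideanSpace ℝ (Fin d)) 1).finite_cover_balls ha
  refine ⟨hfin.toFinset, fun v₀ r hr => ⟨fun c hct => ?_, fun x hx => ?_⟩⟩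
  · apply ball_subset_ball'
    have := ht (hfin.mem_toFinset.1 hct)
    rw [mem_closedBall_zero_iff] at this
    rw [dist_eq_norm, add_sub_cancel_left, norm_smul, Real.norm_of_nonneg hr.le]
    nlinarith
  · have hx' : r⁻¹ • (x - v₀) ∈ closedBall (0 : EuclideanSpace ℝ (Fin d)) 1 := by
      rw [mem_closedBall_zero_iff, norm_smul, Real.norm_of_nonneg (by positivity), inv_mul_le_one₀ hr]
      rw [mem_ball, dist_eq_norm] at hx
      exact hx.le
    obtain ⟨c, hct, hxc⟩ := Set.mem_iUnion₂.1 (hc hx')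
    refine Set.mem_iUnion₂.2 ⟨c, hfin.mem_toFinset.2 hct, ?_⟩
    rw [mem_ball, dist_eq_norm] at *
    have : x - (v₀ + r • c) = r • (r⁻¹ • (x - v₀) - c) := by
      rw [smul_sub, smul_smul, mul_inv_cancel₀ hr.ne']; module
    rw [this, norm_smul, Real.norm_of_nonneg hr.le]
    exact mul_lt_mul_of_pos_left hxc hr

theorem local_inv (d : ℕ) (κ : ℝ) (hκ : 0 < κ)
    (b : EuclideanSpace ℝ (Fin d) → EuclideanSpace ℝ (Fin d))
    (A : EuclideanSpace ℝ (Fin d) → EuclideanSpace ℝ (Fin d) →L[ℝ] EuclideanSpace ℝ (Fin d))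
    (hA : ∀ x ∈ ball (0 : EuclideanSpace ℝ (Fin d)) 1, HasFDerivAt b (A x) x)
    (hAc : ContinuousOn A (ball 0 1))
    (hinv : ∀ v ∈ ball (0 : EuclideanSpace ℝ (Fin d)) 1,
      ∃ L : EuclideanSpace ℝ (Fin d) →L[ℝ] EuclideanSpace ℝ (Fin d),
        (A v).comp L = ContinuousLinearMap.id ℝ _ ∧
        L.comp (A v) = ContinuousLinearMap.id ℝ _ ∧ ‖L‖ ≤ κ) :
    ∃ δ : ℝ, 0 < δ ∧
      (∀ x ∈ ball (0 : EuclideanSpace ℝ (Fin d)) (1/2), ∀ x', ‖x - x'‖ ≤ δ →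
        ‖x - x'‖ ≤ 2 * κ * ‖b x - b x'‖) ∧
      (∀ x ∈ ball (0 : EuclideanSpace ℝ (Fin d)) (1/2), ∀ z, ‖z - b x‖ ≤ δ / (2 * κ) →
        ∃ x', b x' = z ∧ ‖x' - x‖ ≤ 2 * κ * ‖z - b x‖) := by
  have hsub : closedBall (0 : EuclideanSpace ℝ (Fin d)) (3/4) ⊆ ball 0 1 :=
    closedBall_subset_ball (by norm_num)
  have huc := (isCompact_closedBall (0 : EuclideanSpace ℝ (Fin d)) (3/4)).uniformContinuousOn_of_continuous
    (hAc.mono hsub)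
  rw [Metric.uniformContinuousOn_iff] at huc
  obtain ⟨δ₀, hδ₀, hu⟩ := huc (1 / (2 * κ)) (by positivity)
  obtain ⟨δ, hδ, hδ1, hδ2⟩ : ∃ δ, 0 < δ ∧ δ < δ₀ ∧ δ ≤ 1/4 :=
    ⟨min (δ₀ / 2) (1/4), by positivity, (min_le_left _ _).trans_lt (by linarith), min_le_right _ _⟩
  have hcb : ∀ x ∈ ball (0 : EuclideanSpace ℝ (Fin d)) (1/2), closedBall x δ ⊆ closedBall 0 (3/4) := by
    intro x hx
    apply closedBall_subset_closedBall'
    rw [mem_ball] at hx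
    linarith
  have happ : ∀ x ∈ ball (0 : EuclideanSpace ℝ (Fin d)) (1/2),
      ApproximatesLinearOn b (A x) (closedBall x δ) (Real.toNNReal (1 / (2 * κ))) := by
    intro x hx y hy z hz
    rw [Real.coe_toNNReal _ (by positivity)]
    refine (convex_closedBall x δ).norm_image_sub_le_of_norm_hasFDerivWithin_le'
      (fun w hw => (hA w (hsub (hcb x hx hw))).hasFDerivWithinAt) ?_ hz hy
    intro w hw
    rw [← dist_eq_norm]
    exact (hu w (hcb x hx hw) x (hcb x hx (mem_closedBall_self hδ.le))
      (lt_of_le_of_lt hw hδ1)).le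
  have h1 : ∀ x ∈ ball (0 : EuclideanSpace ℝ (Fin d)) (1/2), ∀ x', ‖x - x'‖ ≤ δ →
        ‖x - x'‖ ≤ 2 * κ * ‖b x - b x'‖ := by
    intro x hx x' hxx
    obtain ⟨L, hL1, hL2, hL3⟩ := hinv x (hsub (hcb x hx (mem_closedBall_self hδ.le)))
    have h := happ x hx x (mem_closedBall_self hδ.le) x' (by rwa [mem_closedBall', dist_eq_norm])
    rw [Real.coe_toNNReal _ (by positivity)] at h
    have e : x - x' = L (A x (x - x')) := by
      have := congrArg (fun T => T (x - x')) hL2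
      simpa using this.symm
    have h2 : ‖x - x'‖ ≤ κ * ‖A x (x - x')‖ := by
      conv_lhs => rw [e]
      exact (L.le_opNorm _).trans (mul_le_mul_of_nonneg_right hL3 (norm_nonneg _))
    have h3 : ‖A x (x - x')‖ ≤ ‖b x - b x'‖ + 1 / (2 * κ) * ‖x - x'‖ := by
      have := norm_sub_norm_le (A x (x - x')) (b x - b x')
      rw [norm_sub_rev (A x (x - x'))] at this
      linarith
    have h4 := mul_le_mul_of_nonneg_left h3 hκ.le
    have h5 : κ * (‖b x - b x'‖ + 1 / (2 * κ) * ‖x - x'‖) = κ * ‖b x - b x'‖ + ‖x - x'‖ / 2 := by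
      field_simp
    linarith
  refine ⟨δ, hδ, h1, ?_⟩
  intro x hx z hz
  obtain ⟨L, hL1, hL2, hL3⟩ := hinv x (hsub (hcb x hx (mem_closedBall_self hδ.le)))
  let S : (A x).NonlinearRightInverse :=
    { toFun := L
      nnnorm := Real.toNNReal κ
      bound' := fun y => by
        rw [Real.coe_toNNReal _ hκ.le]
        exact (L.le_opNorm _).trans (mul_le_mul_of_nonneg_right hL3 (norm_nonneg _))
      right_inv' := fun y => by
        have := congrArg (fun T => T y) hL1
        simpa using this }
  have hs := (happ x hx).surjOn_closedBall_of_nonlinearRightInverse S hδ.le subset_rfl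
  have hz' : z ∈ closedBall (b x) (((S.nnnorm : ℝ)⁻¹ - (Real.toNNReal (1 / (2 * κ)) : ℝ)) * δ) := by
    rw [mem_closedBall, dist_eq_norm]
    refine hz.trans (le_of_eq ?_)
    simp only [S]
    rw [Real.coe_toNNReal _ hκ.le, Real.coe_toNNReal _ (by positivity)]
    field_simp
    ring
  obtain ⟨x', hx', rfl⟩ := hs hz'
  refine ⟨x', rfl, ?_⟩
  rw [norm_sub_rev, norm_sub_rev (b x')]
  exact h1 x hx x' (by rwa [← dist_eq_norm, ← mem_closedBall'])

theorem local_bound (d : ℕ) (hd : 1 ≤ d) (κ M : ℝ) (hκ : 0 < κ) (hM : 0 < M)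
    (b : EuclideanSpace ℝ (Fin d) → EuclideanSpace ℝ (Fin d))
    (A : EuclideanSpace ℝ (Fin d) → EuclideanSpace ℝ (Fin d) →L[ℝ] EuclideanSpace ℝ (Fin d))
    (v : EuclideanSpace ℝ (Fin d)) (ρ : ℝ) (hρ : 0 < ρ)
    (hA : ∀ x ∈ ball v ρ, HasFDerivAt b (A x) x)
    (hAM : ∀ x ∈ ball v ρ, ‖A x‖ ≤ M)
    (hinv : ∀ x ∈ ball v ρ,
      ∃ L : EuclideanSpace ℝ (Fin d) →L[ℝ] EuclideanSpace ℝ (Fin d),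
        (A x).comp L = ContinuousLinearMap.id ℝ _ ∧
        L.comp (A x) = ContinuousLinearMap.id ℝ _ ∧ ‖L‖ ≤ κ)
    (hinj : Set.InjOn b (ball v ρ)) (μ ε : ℝ) (ν : EuclideanSpace ℝ (Fin d)) (hν : ‖ν‖ = 1) :
    volume {x : EuclideanSpace ℝ (Fin d) | x ∈ ball v ρ ∧ |μ + ⟪b x, ν⟫| ≤ ε}
      ≤ ENNReal.ofReal (κ ^ d) *
        (ENNReal.ofReal (2 * ε) * ENNReal.ofReal (2 * (M * ρ)) ^ (d - 1)) := by
  set S := {x : EuclideanSpace ℝ (Fin d) | x ∈ ball v ρ ∧ |μ + ⟪b x, ν⟫| ≤ ε} with hS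
  have hSb : S ⊆ ball v ρ := fun x hx => hx.1
  have hbc : ContinuousOn b (ball v ρ) := fun x hx => (hA x hx).continuousAt.continuousWithinAt
  have hSm : MeasurableSet S := by
    have hc : ContinuousOn (fun x => |μ + ⟪b x, ν⟫|) (ball v ρ) :=
      (continuousOn_const.add (hbc.inner continuousOn_const)).abs
    obtain ⟨u, hu, hu2⟩ := continuousOn_iff_isClosed.1 hc (Set.Iic ε) isClosed_Iic
    have : S = (fun x => |μ + ⟪b x, ν⟫|) ⁻¹' (Set.Iic ε) ∩ ball v ρ := by
      ext x; simp [hS, and_comm]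
    rw [this, hu2]
    exact hu.measurableSet.inter measurableSet_ball
  have hcv := lintegral_abs_det_fderiv_eq_addHaar_image volume hSm
    (fun x hx => (hA x (hSb hx)).hasFDerivWithinAt) (hinj.mono hSb)
  have himg : b '' S ⊆ {y | y ∈ closedBall (b v) (M * ρ) ∧ |μ + ⟪y, ν⟫| ≤ ε} := by
    rintro _ ⟨x, hx, rfl⟩
    refine ⟨?_, hx.2⟩
    rw [mem_closedBall, dist_eq_norm]
    have h1 := (convex_ball v ρ).norm_image_sub_le_of_norm_hasFDerivWithin_le
      (fun w hw => (hA w hw).hasFDerivWithinAt) hAM (mem_ball_self hρ) hx.1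
    refine h1.trans (mul_le_mul_of_nonneg_left ?_ hM.le)
    have := hx.1
    rw [mem_ball, dist_eq_norm] at this
    exact this.le
  have hdet : ∀ x ∈ S, 1 ≤ ENNReal.ofReal (κ ^ d) * ENNReal.ofReal |(A x).det| := by
    intro x hx
    obtain ⟨L, hL1, hL2, hL3⟩ := hinv x (hSb hx)
    have h1 := det_bound d κ hκ L hL3
    have h2 : L.det * (A x).det = 1 := by
      have := congrArg (fun T : EuclideanSpace ℝ (Fin d) →L[ℝ] EuclideanSpace ℝ (Fin d) =>
        LinearMap.det (T : EuclideanSpace ℝ (Fin d) →ₗ[ℝ] EuclideanSpace ℝ (Fin d))) hL2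
      simp only [ContinuousLinearMap.coe_comp, LinearMap.det_comp] at this
      simpa [ContinuousLinearMap.det] using this
    rw [← ENNReal.ofReal_mul (by positivity), ENNReal.one_le_ofReal]
    calc (1 : ℝ) = |L.det| * |(A x).det| := by rw [← abs_mul, h2, abs_one]
      _ ≤ _ := mul_le_mul_of_nonneg_right h1 (abs_nonneg _)
  calc volume S = ∫⁻ x in S, 1 := by simp
    _ ≤ ∫⁻ x in S, ENNReal.ofReal (κ ^ d) * ENNReal.ofReal |(A x).det| :=
        setLIntegral_mono' hSm hdet
    _ = ENNReal.ofReal (κ ^ d) * volume (b '' S) := by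
        rw [lintegral_const_mul' _ _ ENNReal.ofReal_ne_top, hcv]
    _ ≤ _ := by
        gcongr
        exact (measure_mono himg).trans (slab_vol d hd _ ν hν _ μ ε)

/-- **Invertibility of `Db` implies nondegeneracy.** If `b ∈ C¹(B₁; ℝ^d)` has an
everywhere invertible Jacobian on `B₁` with `‖Db(v)⁻¹‖ ≤ κ` and `‖Db‖_{L^∞(B₁)} ≤ M`,
then `b` satisfies condition (N) on `B_{1/2}` with a constant `K > 0` depending only
on `d`, `κ` and `M`. -/
theorem invertible_jacobian_implies_condN (d : ℕ) (hd : 1 ≤ d) (κ M : ℝ)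
    (hκ : 0 < κ) (hM : 0 < M) :
    ∃ K : ℝ, 0 < K ∧
      ∀ b : EuclideanSpace ℝ (Fin d) → EuclideanSpace ℝ (Fin d),
        ContDiffOn ℝ 1 b (ball 0 1) →
        (∀ v ∈ ball (0 : EuclideanSpace ℝ (Fin d)) 1,
          ‖fderivWithin ℝ b (ball 0 1) v‖ ≤ M ∧
          ∃ L : EuclideanSpace ℝ (Fin d) →L[ℝ] EuclideanSpace ℝ (Fin d),
            (fderivWithin ℝ b (ball 0 1) v).comp L = ContinuousLinearMap.id ℝ _ ∧
            L.comp (fderivWithin ℝ b (ball 0 1) v) = ContinuousLinearMap.id ℝ _ ∧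
            ‖L‖ ≤ κ) →
        CondN d K (ball 0 (1/2)) b := by
  have hpos : 0 < 1 + 4 * κ * M := by positivity
  obtain ⟨t, ht⟩ := cover d (1 / (1 + 4 * κ * M)) (by positivity)
  refine ⟨(t.card + 1) * (κ ^ d * (2 * (2 * M) ^ (d - 1))), by positivity, ?_⟩
  intro b hb hD v₀ r hr hball μ ε ν hν hε
  set A := fderivWithin ℝ b (ball 0 1) with hAdef
  have hA : ∀ x ∈ ball (0 : EuclideanSpace ℝ (Fin d)) 1, HasFDerivAt b (A x) x := fun x hx =>
    ((hb.differentiableOn one_ne_zero x hx).hasFDerivWithinAt).hasFDerivAt (isOpen_ball.mem_nhds hx)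
  have hAc : ContinuousOn A (ball 0 1) :=
    hb.continuousOn_fderivWithin isOpen_ball.uniqueDiffOn (by norm_num)
  obtain ⟨δ, hδ, hi, hii⟩ := local_inv d κ hκ b A hA hAc (fun v hv => (hD v hv).2)
  obtain ⟨ht1, ht2⟩ := ht v₀ r hr
  obtain ⟨ρ, hρ⟩ : ∃ ρ, ρ = r * (1 / (1 + 4 * κ * M)) := ⟨_, rfl⟩
  rw [← hρ] at ht2
  have hρ0 : 0 < ρ := by rw [hρ]; positivity
  have hρ1 : ρ * (1 + 4 * κ * M) = r := by rw [hρ]; field_simp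
  have hρr : ρ ≤ r := by rw [← hρ1]; nlinarith [mul_pos hκ hM]
  have hhalf : ball (0 : EuclideanSpace ℝ (Fin d)) (1/2) ⊆ ball 0 1 :=
    ball_subset_ball (by norm_num)
  have hloc : ∀ c ∈ t, volume {x | x ∈ ball (v₀ + r • c) ρ ∧ |μ + ⟪b x, ν⟫| ≤ ε}
      ≤ ENNReal.ofReal (κ ^ d * (2 * (2 * M) ^ (d - 1)) * r ^ (d - 1) * ε) := by
    intro c hc
    have hs1 : ball (v₀ + r • c) r ⊆ ball 0 (1/2) := (ht1 c hc).trans hball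
    have hs2 := hs1.trans hhalf
    have hs3 : ball (v₀ + r • c) ρ ⊆ ball 0 1 := (ball_subset_ball hρr).trans hs2
    have hinj := chain_inj b (v₀ + r • c) r δ κ M hδ hκ hM
      (fun x hx x' _ h => hi x (hs1 hx) x' h) (fun x hx z h => hii x (hs1 hx) z h)
      (fun x hx x' hx' => (convex_ball _ r).norm_image_sub_le_of_norm_hasFDerivWithin_le
        (fun w hw => (hA w (hs2 hw)).hasFDerivWithinAt) (fun w hw => (hD w (hs2 hw)).1) hx' hx)
      ρ hρ1
    refine (local_bound d hd κ M hκ hM b A _ ρ hρ0 (fun x hx => hA x (hs3 hx))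
      (fun x hx => (hD x (hs3 hx)).1) (fun x hx => (hD x (hs3 hx)).2) hinj μ ε ν hν).trans ?_
    rw [← ENNReal.ofReal_pow (by positivity), ← ENNReal.ofReal_mul (by positivity),
      ← ENNReal.ofReal_mul (by positivity)]
    apply ENNReal.ofReal_le_ofReal
    calc κ ^ d * (2 * ε * (2 * (M * ρ)) ^ (d - 1)) ≤ κ ^ d * (2 * ε * (2 * (M * r)) ^ (d - 1)) := by
          gcongr
      _ = _ := by rw [← mul_assoc 2 M r, mul_pow (2 * M) r]; ring
  have hrp : r ^ ((d : ℝ) - 1) = r ^ (d - 1) := by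
    rw [← Real.rpow_natCast, Nat.cast_sub hd, Nat.cast_one]
  rw [hrp]
  have hsub : {v : EuclideanSpace ℝ (Fin d) | v ∈ ball v₀ r ∧ |μ + ⟪b v, ν⟫| ≤ ε}
      ⊆ ⋃ c ∈ t, {x | x ∈ ball (v₀ + r • c) ρ ∧ |μ + ⟪b x, ν⟫| ≤ ε} := by
    rintro x ⟨hx, hx2⟩
    obtain ⟨c, hc, hxc⟩ := Set.mem_iUnion₂.1 (ht2 hx)
    exact Set.mem_iUnion₂.2 ⟨c, hc, hxc, hx2⟩
  refine (measure_mono hsub).trans ((measure_biUnion_finset_le t _).trans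
    ((Finset.sum_le_sum hloc).trans ?_))
  rw [Finset.sum_const, nsmul_eq_mul, ← ENNReal.ofReal_natCast, ← ENNReal.ofReal_mul (by positivity)]
  apply ENNReal.ofReal_le_ofReal
  have : 0 ≤ κ ^ d * (2 * (2 * M) ^ (d - 1)) * r ^ (d - 1) * ε := by positivity
  nlinarith
end

section
/- De Giorgi recursion: Let ε > 0, C > 1, and set m := C^{1/ε} > 1. There exists a constant C₀ > 0 depending only on ε and C such that the following holds. Let S ≥ 0 and let (A_n)_{n≥0} be a sequence of nonnegative reals with A₀ + S > 0, set l := C₀(S + A₀), and suppose that A_n ≤ C^n (l + S) l^{−(1+ε)} A_{n−1}^{1+ε} for every n ≥ 1. Then A_n ≤ A₀ m^{−n} for every n ≥ 0; in particular A_n → 0 as n → ∞. -/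
/-- **De Giorgi recursion.** Let `ε > 0`, `C > 1`, `m := C ^ (1/ε) > 1`. There is
`C₀ > 0` depending only on `ε` and `C` such that: if `S ≥ 0`, `(Aₙ)` is a sequence of
nonnegative reals with `A₀ + S > 0`, `l := C₀ (S + A₀)`, and
`Aₙ ≤ Cⁿ (l + S) l^{-(1+ε)} A_{n-1}^{1+ε}` for all `n ≥ 1`, then `Aₙ ≤ A₀ m^{-n}`
for all `n`. -/
theorem deGiorgi_recursion (ε C : ℝ) (hε : 0 < ε) (hC : 1 < C) :
    ∃ C₀ : ℝ, 0 < C₀ ∧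
      ∀ (S : ℝ) (A : ℕ → ℝ), 0 ≤ S → (∀ n, 0 ≤ A n) → 0 < A 0 + S →
        (∀ n : ℕ, 1 ≤ n →
          A n ≤ C ^ (n : ℝ) * (C₀ * (S + A 0) + S) * (C₀ * (S + A 0)) ^ (-(1 + ε))
            * A (n - 1) ^ (1 + ε)) →
        ∀ n : ℕ, A n ≤ A 0 * (C ^ (1 / ε)) ^ (-(n : ℝ)) := by
  have hC0 : 0 < C := by linarith
  obtain ⟨m, hm⟩ : ∃ m, m = C ^ (1 / ε) := ⟨_, rfl⟩
  have hm1 : 1 ≤ m := by rw [hm]; exact Real.one_le_rpow hC.le (by positivity)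
  have hm0 : 0 < m := by linarith
  have hmε : m ^ ε = C := by
    rw [hm, ← Real.rpow_mul hC0.le, one_div, inv_mul_cancel₀ hε.ne', Real.rpow_one]
  rw [← hm]
  have hD : 1 ≤ 2 * (C * m) := by nlinarith
  obtain ⟨D, hDD⟩ : ∃ D, D = (2 * (C * m)) ^ (1 / ε) := ⟨_, rfl⟩
  have hD1 : 1 ≤ D := by rw [hDD]; exact Real.one_le_rpow hD (by positivity)
  have hD0 : 0 < D := by linarith
  have hDε : D ^ ε = 2 * (C * m) := by
    rw [hDD, ← Real.rpow_mul (by linarith), one_div, inv_mul_cancel₀ hε.ne', Real.rpow_one]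
  refine ⟨D, hD0, ?_⟩
  intro S A hS hA hpos hrec
  have hT : 0 < S + A 0 := by linarith
  have hl : 0 < D * (S + A 0) := by positivity
  obtain ⟨K, hK⟩ : ∃ K, K = (D * (S + A 0) + S) * (D * (S + A 0)) ^ (-(1 + ε)) := ⟨_, rfl⟩
  have hK0 : 0 ≤ K := by rw [hK]; positivity
  have hkey : K * A 0 ^ ε * (C * m) ≤ 1 := by
    have h1 : K ≤ 2 * ((D * (S + A 0)) ^ ε)⁻¹ := by
      have hSl : S ≤ D * (S + A 0) := by nlinarith [hA 0]
      calc K ≤ (2 * (D * (S + A 0))) * (D * (S + A 0)) ^ (-(1 + ε)) := by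
            rw [hK]; gcongr; linarith
        _ = 2 * ((D * (S + A 0)) ^ ε)⁻¹ := by
            rw [Real.rpow_neg hl.le, Real.rpow_add hl, Real.rpow_one]
            have := (Real.rpow_pos_of_pos hl ε).ne'
            field_simp
    have h2 : A 0 ^ ε ≤ (S + A 0) ^ ε := Real.rpow_le_rpow (hA 0) (by linarith) hε.le
    have hTε := Real.rpow_pos_of_pos hT ε
    calc K * A 0 ^ ε * (C * m)
        ≤ (2 * ((D * (S + A 0)) ^ ε)⁻¹) * (S + A 0) ^ ε * (C * m) := by
          have := Real.rpow_nonneg (hA 0) ε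
          gcongr
      _ = 1 := by
          rw [Real.mul_rpow hD0.le hT.le, hDε]
          field_simp
      _ ≤ 1 := le_rfl
  intro n
  induction n with
  | zero => simp
  | succ n ih =>
    have h := hrec (n + 1) (by omega)
    rw [Nat.add_sub_cancel, mul_assoc (C ^ _), ← hK] at h
    obtain ⟨q, hq⟩ : ∃ q, q = m ^ (-(n : ℝ)) := ⟨_, rfl⟩
    have hq0 : 0 < q := by rw [hq]; positivity
    have hqε : C ^ (n : ℝ) * q ^ ε = 1 := by
      rw [hq, ← Real.rpow_mul hm0.le, mul_comm (-(n : ℝ)), Real.rpow_mul hm0.le, hmε,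
        ← Real.rpow_add hC0]
      simp
    have hq' : m ^ (-((n + 1 : ℕ) : ℝ)) = q * m⁻¹ := by
      rw [hq]; push_cast
      rw [neg_add, Real.rpow_add hm0, Real.rpow_neg_one]
    rw [← hq] at ih
    rw [hq']
    have hC' : C ^ ((n + 1 : ℕ) : ℝ) = C ^ (n : ℝ) * C := by
      push_cast
      rw [Real.rpow_add hC0, Real.rpow_one]
    have hpw : A n ^ (1 + ε) ≤ (A 0 * A 0 ^ ε) * (q * q ^ ε) := by
      calc A n ^ (1 + ε) ≤ (A 0 * q) ^ (1 + ε) :=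
            Real.rpow_le_rpow (hA n) ih (by linarith)
        _ = _ := by
            rw [Real.mul_rpow (hA 0) hq0.le, Real.rpow_add' (hA 0) (by positivity),
              Real.rpow_add hq0, Real.rpow_one, Real.rpow_one]
    calc A (n + 1) ≤ C ^ (n : ℝ) * C * K * A n ^ (1 + ε) := by rw [← hC']; exact h
      _ ≤ C ^ (n : ℝ) * C * K * ((A 0 * A 0 ^ ε) * (q * q ^ ε)) := by gcongr
      _ = (C ^ (n : ℝ) * q ^ ε) * (K * A 0 ^ ε * (C * m)) * (A 0 * (q * m⁻¹)) := by
          field_simp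
      _ ≤ 1 * 1 * (A 0 * (q * m⁻¹)) := by
          rw [hqε]
          have := hA 0
          gcongr
      _ = _ := by ring
end
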